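/- Let n ≥ 1, let q, λ, μ ∈ ℂ with q nonzero and not a root of unity, λ ≠ 0, let α ∈ ℤ_{≥0}^{n+1}, s ∈ ℤ_{≥0}^n, and p ∈ ℤ_{≥0}^n with p_i ≤ min(s_i, α_i) for 1 ≤ i ≤ n, and assume (μ;q)_{|s|} ≠ 0 and (μ;q)_{|α|} ≠ 0. Set s^∨ = (s_1,…,s_n,0) ∈ ℤ_{≥0}^{n+1}. Then Σ_{m ∈ ℤ_{≥0}^n, m ≤ s} q^{φ(m,α)} Φ_q^{(n)}(m|s;λ,μ) ∏_{i=1}^n q^{(m_i−p_i)(α_i−p_i)} binom(α_i,p_i)_q binom(m_i,p_i)_q = Σ_{γ ∈ ℤ_{≥0}^{n+1}, γ ≤ α} q^{φ(γ,α) + φ(s^∨−α, γ)} Φ_q^{(n+1)}(γ|α;λ,μ) ∏_{i=1}^n q^{(γ_i−p_i)(s_i−p_i)} binom(s_i,p_i)_q binom(γ_i,p_i)_q, where in φ(m,α) the vector m is padded with a trailing zero to length n+1. -/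

import Mathlib

/-- The q-Pochhammer symbol `(z;q)_m = ∏_{j=0}^{m-1} (1 - z q^j)`. -/
noncomputable def qPoch (q z : ℂ) (m : ℕ) : ℂ := ∏ j ∈ Finset.range m, (1 - z * q ^ j)

/-- The q-binomial coefficient `binom(m,k)_q`. -/
noncomputable def qBinom (q : ℂ) (m k : ℕ) : ℂ :=
  if k ≤ m then qPoch q q m / (qPoch q q k * qPoch q q (m - k)) else 0

/-- `q` is not a root of unity. -/
def notRootOfUnity (q : ℂ) : Prop := ∀ m : ℕ, 0 < m → q ^ m ≠ 1

/-- `φ(β,γ) = Σ_{1 ≤ i < j ≤ k} β_i γ_j` for integer vectors. -/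
def phi {k : ℕ} (β γ : Fin k → ℤ) : ℤ :=
  ∑ i, ∑ j, if i < j then β i * γ j else 0

open Classical in
/-- The weight `Φ_q^{(n)}(γ|β;λ,μ)` of the stochastic R matrix of `U_q(A^{(1)}_n)`. -/
noncomputable def Phi (n : ℕ) (q lam mu : ℂ) (γ β : Fin n → ℕ) : ℂ :=
  if γ ≤ β then
    q ^ phi (fun i => (β i : ℤ) - (γ i : ℤ)) (fun i => (γ i : ℤ))
      * (mu / lam) ^ (∑ i, γ i)
      * qPoch q lam (∑ i, γ i) * qPoch q (mu / lam) ((∑ i, β i) - ∑ i, γ i)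
      * (∏ i, qBinom q (β i) (γ i)) / qPoch q mu (∑ i, β i)
  else 0

open Polynomial

section QBinomial

variable {q : ℂ}

lemma qPoch_succ (q z : ℂ) (m : ℕ) : qPoch q z (m + 1) = qPoch q z m * (1 - z * q ^ m) :=
  Finset.prod_range_succ _ _

lemma qPoch_ne_zero_of_le {z : ℂ} {m k : ℕ} (h : m ≤ k) (hk : qPoch q z k ≠ 0) :
    qPoch q z m ≠ 0 := by
  rw [qPoch, Finset.prod_ne_zero_iff] at hk ⊢
  exact fun j hj => hk j (Finset.mem_range.2 ((Finset.mem_range.1 hj).trans_le h))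

lemma notRootOfUnity.one_sub_ne_zero (hq : notRootOfUnity q) (j : ℕ) : 1 - q * q ^ j ≠ 0 := by
  rw [← pow_succ', sub_ne_zero]
  exact (hq _ j.succ_pos).symm

lemma notRootOfUnity.qPoch_self_ne_zero (hq : notRootOfUnity q) (m : ℕ) : qPoch q q m ≠ 0 :=
  Finset.prod_ne_zero_iff.2 fun j _ => hq.one_sub_ne_zero j

lemma qBinom_of_lt {m k : ℕ} (h : m < k) : qBinom q m k = 0 := if_neg h.not_ge

lemma qBinom_add (q : ℂ) (k d : ℕ) :
    qBinom q (k + d) k = qPoch q q (k + d) / (qPoch q q k * qPoch q q d) := by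
  simp [qBinom]

lemma qBinom_zero_right (hq : notRootOfUnity q) (m : ℕ) : qBinom q m 0 = 1 := by
  simpa [qBinom, qPoch] using hq.qPoch_self_ne_zero m

lemma qBinom_self (hq : notRootOfUnity q) (m : ℕ) : qBinom q m m = 1 := by
  simpa [qBinom, qPoch] using hq.qPoch_self_ne_zero m

/-- The `q`-Pascal rule. -/
lemma qBinom_succ_succ (hq : notRootOfUnity q) {s m : ℕ} (h : m ≤ s) :
    q ^ m * qBinom q (s + 1) (m + 1) = q ^ m * qBinom q s (m + 1) + q ^ s * qBinom q s m := by
  obtain rfl | h := h.eq_or_lt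
  · simp [qBinom_self hq, qBinom_of_lt]
  · obtain ⟨d, rfl⟩ := Nat.exists_eq_add_of_lt h
    rw [show m + d + 1 + 1 = (m + 1) + (d + 1) by ring, qBinom_add,
      show m + d + 1 = (m + 1) + d by ring, qBinom_add,
      show m + 1 + d = m + (d + 1) by ring, qBinom_add,
      show m + 1 + (d + 1) = (m + (d + 1)) + 1 by ring, qPoch_succ q q (m + (d + 1)),
      qPoch_succ q q m, qPoch_succ q q d]
    have h1 := hq.qPoch_self_ne_zero m
    have h2 := hq.qPoch_self_ne_zero d
    have h3 := hq.one_sub_ne_zero m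
    have h4 := hq.one_sub_ne_zero d
    generalize hx : 1 - q * q ^ m = x at *
    field_simp
    rw [← hx]
    ring

lemma qBinom_mul_qBinom (hq : notRootOfUnity q) (p : ℕ) {s m : ℕ} (h : m ≤ s) :
    qBinom q (p + s) (p + m) * qBinom q (p + m) p = qBinom q (p + s) p * qBinom q s m := by
  obtain ⟨d, rfl⟩ := Nat.exists_eq_add_of_le h
  rw [qBinom_add, qBinom_add, ← add_assoc, qBinom_add, add_assoc, qBinom_add]
  have h1 := hq.qPoch_self_ne_zero p
  have h2 := hq.qPoch_self_ne_zero m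
  have h3 := hq.qPoch_self_ne_zero d
  have h4 := hq.qPoch_self_ne_zero (p + m)
  have h5 := hq.qPoch_self_ne_zero (m + d)
  field_simp

/-- The `q`-binomial theorem. -/
lemma prod_one_add_eq_sum_qBinom (hq : notRootOfUnity q) (y : ℂ[X]) (s : ℕ) :
    ∏ r ∈ Finset.range s, (1 + C (q ^ r) * y)
      = ∑ m ∈ Finset.range (s + 1), C (qBinom q s m * q ^ m.choose 2) * y ^ m := by
  induction s with
  | zero => simp [qBinom_self hq]
  | succ s ih =>
    have key : ∀ m ∈ Finset.range (s + 1),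
        C (qBinom q (s + 1) (m + 1) * q ^ (m + 1).choose 2) * y ^ (m + 1)
          = C (qBinom q s (m + 1) * q ^ (m + 1).choose 2) * y ^ (m + 1)
            + C (q ^ s) * y * (C (qBinom q s m * q ^ m.choose 2) * y ^ m) := by
      intro m hm
      have h := qBinom_succ_succ hq (Nat.lt_succ_iff.1 (Finset.mem_range.1 hm))
      have h' : qBinom q (s + 1) (m + 1) * q ^ (m + 1).choose 2
          = qBinom q s (m + 1) * q ^ (m + 1).choose 2
            + q ^ s * (qBinom q s m * q ^ m.choose 2) := by
        rw [show (m + 1).choose 2 = m + m.choose 2 by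
          rw [Nat.choose_succ_succ' m 1, Nat.choose_one_right], pow_add]
        linear_combination q ^ m.choose 2 * h
      rw [h', C_add, C_mul (a := q ^ s)]
      ring
    rw [Finset.prod_range_succ, ih, Finset.sum_range_succ' _ (s + 1), Finset.sum_congr rfl key,
      Finset.sum_add_distrib, ← Finset.mul_sum]
    have h0 : ∑ m ∈ Finset.range (s + 1), C (qBinom q s m * q ^ m.choose 2) * y ^ m
        = ∑ m ∈ Finset.range (s + 1), C (qBinom q s (m + 1) * q ^ (m + 1).choose 2) * y ^ (m + 1)
          + C (qBinom q (s + 1) 0 * q ^ (0 : ℕ).choose 2) * y ^ 0 := by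
      rw [qBinom_zero_right hq, ← qBinom_zero_right hq s,
        ← Finset.sum_range_succ' (fun m => C (qBinom q s m * q ^ m.choose 2) * y ^ m),
        Finset.sum_range_succ _ (s + 1)]
      simp [qBinom_of_lt]
    linear_combination h0

end QBinomial

/-- The polynomial `∏_{r=0}^{b-1} (1 + q^{a+r} X)`. -/
noncomputable def qShiftedProd (q : ℂ) (a b : ℕ) : ℂ[X] :=
  ∏ r ∈ Finset.range b, (1 + C (q ^ (a + r)) * X)

section ShiftedProd

variable (q : ℂ)

lemma qShiftedProd_succ (a b : ℕ) :
    qShiftedProd q a (b + 1) = qShiftedProd q a b * (1 + C (q ^ (a + b)) * X) :=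
  Finset.prod_range_succ _ _

lemma qShiftedProd_add (a b : ℕ) :
    qShiftedProd q 0 (a + b) = qShiftedProd q 0 a * qShiftedProd q a b := by
  simp [qShiftedProd, Finset.prod_range_add]

lemma qShiftedProd_ne_zero (a b : ℕ) : qShiftedProd q a b ≠ 0 := by
  refine Finset.prod_ne_zero_iff.2 fun r _ h => ?_
  simpa using congrArg (eval 0) h

lemma natDegree_one_add_C_mul_X_le (c : ℂ) : (1 + C c * X : ℂ[X]).natDegree ≤ 1 := by
  rw [add_comm, ← C_1]
  exact natDegree_linear_le

lemma natDegree_qShiftedProd_le (a b : ℕ) : (qShiftedProd q a b).natDegree ≤ b := by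
  refine (natDegree_prod_le _ _).trans ?_
  refine (Finset.sum_le_card_nsmul _ _ 1 fun r _ => natDegree_one_add_C_mul_X_le _).trans ?_
  simp

variable {q} in
lemma qShiftedProd_eq_sum (hq : notRootOfUnity q) (a b : ℕ) :
    qShiftedProd q a b
      = ∑ m ∈ Finset.range (b + 1), C (qBinom q b m * q ^ (m.choose 2 + a * m)) * X ^ m := by
  have h := prod_one_add_eq_sum_qBinom hq (C (q ^ a) * X) b
  convert h using 1
  · refine Finset.prod_congr rfl fun r _ => ?_
    rw [← mul_assoc, ← C_mul, ← pow_add, add_comm a r]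
  · refine Finset.sum_congr rfl fun m _ => ?_
    rw [mul_pow, ← C_pow, ← mul_assoc, ← C_mul, pow_add, pow_mul, mul_assoc]

end ShiftedProd

/-- The sum of the entries of `s` before position `k` and of those of `α` from position `k` on. -/
def mixedSum {N : ℕ} (s α : Fin N → ℕ) (k : Fin (N + 1)) : ℕ :=
  ∑ j : Fin N, if j.castSucc < k then s j else α j

section MixedSum

variable {N : ℕ} (s α : Fin N → ℕ)

lemma mixedSum_zero : mixedSum s α 0 = ∑ j, α j := by simp [mixedSum]

lemma mixedSum_last : mixedSum s α (Fin.last N) = ∑ j, s j := by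
  simp [mixedSum, Fin.castSucc_lt_last]

lemma mixedSum_castSucc_add (i : Fin N) :
    mixedSum s α i.castSucc + s i = mixedSum s α i.succ + α i := by
  rw [← Fintype.sum_ite_eq i s, ← Fintype.sum_ite_eq i α, mixedSum, mixedSum,
    ← Finset.sum_add_distrib, ← Finset.sum_add_distrib]
  refine Finset.sum_congr rfl fun j _ => ?_
  simp only [Fin.castSucc_lt_castSucc_iff, Fin.castSucc_lt_succ_iff]
  rcases lt_trichotomy i j with h | rfl | h
  · simp [h.not_ge, h.not_gt, h.ne]
  · simp [add_comm]
  · simp [h, h.le, h.ne']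

lemma prod_qShiftedProd_mixedSum (q : ℂ) {T : ℕ} (hs : ∑ i, s i ≤ T) (hα : ∑ i, α i ≤ T) :
    (∏ i, qShiftedProd q (mixedSum s α i.castSucc) (s i))
        * qShiftedProd q (∑ i, s i) (T - ∑ i, s i)
      = (∏ i, qShiftedProd q (mixedSum s α i.succ) (α i))
        * qShiftedProd q (∑ i, α i) (T - ∑ i, α i) := by
  have hne : (∏ k, qShiftedProd q 0 (mixedSum s α k)) ≠ 0 :=
    Finset.prod_ne_zero_iff.2 fun k _ => qShiftedProd_ne_zero q _ _
  have hsplit : ∀ S ≤ T, qShiftedProd q 0 T = qShiftedProd q 0 S * qShiftedProd q S (T - S) :=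
    fun S hS => by rw [← qShiftedProd_add, Nat.add_sub_cancel' hS]
  have hl : (∏ k, qShiftedProd q 0 (mixedSum s α k))
      = (∏ i : Fin N, qShiftedProd q 0 (mixedSum s α i.castSucc))
        * qShiftedProd q 0 (∑ i, s i) := by
    rw [Fin.prod_univ_castSucc, mixedSum_last]
  have hr : (∏ k, qShiftedProd q 0 (mixedSum s α k))
      = qShiftedProd q 0 (∑ i, α i)
        * ∏ i : Fin N, qShiftedProd q 0 (mixedSum s α i.succ) := by
    rw [Fin.prod_univ_succ, mixedSum_zero]
  have hu : (∏ i : Fin N, qShiftedProd q 0 (mixedSum s α i.castSucc))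
        * ∏ i, qShiftedProd q (mixedSum s α i.castSucc) (s i)
      = (∏ i : Fin N, qShiftedProd q 0 (mixedSum s α i.succ))
        * ∏ i, qShiftedProd q (mixedSum s α i.succ) (α i) := by
    simp only [← Finset.prod_mul_distrib, ← qShiftedProd_add, mixedSum_castSucc_add]
  refine mul_left_cancel₀ hne ?_
  calc
    _ = ((∏ i : Fin N, qShiftedProd q 0 (mixedSum s α i.castSucc))
          * ∏ i, qShiftedProd q (mixedSum s α i.castSucc) (s i)) * qShiftedProd q 0 T := by
      rw [hl, hsplit _ hs]
      ring
    _ = _ := by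
      rw [hu, hr, hsplit _ hα]
      ring

end MixedSum

/-- The linear functional `X^k ↦ q^{-k(k-1)/2} W(k,N)` on polynomials of degree at most `N`. -/
noncomputable def qMoment (q : ℂ) (W : ℕ → ℕ → ℂ) (N : ℕ) (P : ℂ[X]) : ℂ :=
  ∑ k ∈ Finset.range (N + 1), P.coeff k * ((q ^ k.choose 2)⁻¹ * W k N)

section Moment

variable {q : ℂ} {W : ℕ → ℕ → ℂ}

lemma qMoment_mul_one_add (hq0 : q ≠ 0) {N : ℕ}
    (hW : ∀ k ≤ N, W k N = W k (N + 1) + q ^ (N - k) * W (k + 1) (N + 1))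
    {P : ℂ[X]} (hP : P.natDegree ≤ N) :
    qMoment q W (N + 1) (P * (1 + C (q ^ N) * X)) = qMoment q W N P := by
  have hc : ∀ k, (P * (1 + C (q ^ N) * X)).coeff k
      = P.coeff k + q ^ N * (P * X).coeff k := by
    intro k
    rw [mul_add, mul_one, coeff_add, mul_left_comm, coeff_C_mul]
  simp only [qMoment, hc, add_mul, Finset.sum_add_distrib]
  rw [Finset.sum_range_succ _ (N + 1), Finset.sum_range_succ' _ (N + 1),
    coeff_eq_zero_of_natDegree_lt (Nat.lt_succ_of_le hP)]
  simp only [coeff_mul_X, coeff_mul_X_zero, mul_zero, zero_mul, add_zero]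
  rw [← Finset.sum_add_distrib]
  refine Finset.sum_congr rfl fun k hk => ?_
  have hk : k ≤ N := Nat.lt_succ_iff.1 (Finset.mem_range.1 hk)
  rw [hW k hk, show (k + 1).choose 2 = k + k.choose 2 by
    rw [Nat.choose_succ_succ' k 1, Nat.choose_one_right]]
  obtain ⟨d, rfl⟩ := Nat.exists_eq_add_of_le hk
  rw [Nat.add_sub_cancel_left, pow_add, pow_add]
  field_simp

lemma qMoment_mul_qShiftedProd (hq0 : q ≠ 0) (N d : ℕ)
    (hW : ∀ M < N + d, ∀ k ≤ M, W k M = W k (M + 1) + q ^ (M - k) * W (k + 1) (M + 1))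
    {P : ℂ[X]} (hP : P.natDegree ≤ N) :
    qMoment q W (N + d) (P * qShiftedProd q N d) = qMoment q W N P := by
  induction d with
  | zero => simp [qShiftedProd]
  | succ d ih =>
    rw [qShiftedProd_succ, ← mul_assoc, ← add_assoc,
      qMoment_mul_one_add hq0 (hW _ (by omega))
        (natDegree_mul_le.trans (add_le_add hP (natDegree_qShiftedProd_le q N d))),
      ih fun M hM => hW M (by omega)]

lemma qMoment_prod_qShiftedProd (hq : notRootOfUnity q) {N : ℕ} (c s : Fin N → ℕ) :
    qMoment q W (∑ i, s i) (∏ i, qShiftedProd q (c i) (s i))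
      = ∑ m ∈ Finset.Iic s, (∏ i, qBinom q (s i) (m i) * q ^ ((m i).choose 2 + c i * m i))
          * ((q ^ (∑ i, m i).choose 2)⁻¹ * W (∑ i, m i) (∑ i, s i)) := by
  have hset : Fintype.piFinset (fun i => Finset.range (s i + 1)) = Finset.Iic s := by
    ext m
    simp [Pi.le_def]
  simp only [qShiftedProd_eq_sum hq]
  rw [Finset.prod_univ_sum, hset, qMoment]
  simp only [Finset.prod_mul_distrib, ← map_prod, Finset.prod_pow_eq_pow_sum, finsetSum_coeff,
    coeff_C_mul_X_pow, Finset.sum_mul]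
  rw [Finset.sum_comm]
  refine Finset.sum_congr rfl fun m hm => ?_
  have hle : ∑ i, m i ≤ ∑ i, s i := Finset.sum_le_sum fun i _ => Finset.mem_Iic.1 hm i
  simp only [ite_mul, zero_mul]
  rw [Finset.sum_ite_eq', if_pos (Finset.mem_range.2 (Nat.lt_succ_of_le hle))]

/-- The duality between `s` and `α` for weights satisfying a Pascal-type recurrence. -/
lemma sum_mixedSum_duality (hq0 : q ≠ 0) (hq : notRootOfUnity q) {N : ℕ} (s α : Fin N → ℕ)
    (hW : ∀ M < max (∑ i, s i) (∑ i, α i), ∀ k ≤ M,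
      W k M = W k (M + 1) + q ^ (M - k) * W (k + 1) (M + 1)) :
    ∑ m ∈ Finset.Iic s,
        (∏ i, qBinom q (s i) (m i) * q ^ ((m i).choose 2 + mixedSum s α i.castSucc * m i))
          * ((q ^ (∑ i, m i).choose 2)⁻¹ * W (∑ i, m i) (∑ i, s i))
      = ∑ m ∈ Finset.Iic α,
        (∏ i, qBinom q (α i) (m i) * q ^ ((m i).choose 2 + mixedSum s α i.succ * m i))
          * ((q ^ (∑ i, m i).choose 2)⁻¹ * W (∑ i, m i) (∑ i, α i)) := by
  have hdeg : ∀ c t : Fin N → ℕ,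
      (∏ i, qShiftedProd q (c i) (t i)).natDegree ≤ ∑ i, t i := fun c t =>
    (natDegree_prod_le _ _).trans (Finset.sum_le_sum fun i _ => natDegree_qShiftedProd_le _ _ _)
  have pad : ∀ c t : Fin N → ℕ, ∑ i, t i ≤ max (∑ i, s i) (∑ i, α i) →
      qMoment q W (∑ i, t i) (∏ i, qShiftedProd q (c i) (t i))
        = qMoment q W (max (∑ i, s i) (∑ i, α i)) ((∏ i, qShiftedProd q (c i) (t i))
          * qShiftedProd q (∑ i, t i) (max (∑ i, s i) (∑ i, α i) - ∑ i, t i)) := by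
    intro c t ht
    have h := qMoment_mul_qShiftedProd (W := W) hq0 (∑ i, t i)
      (max (∑ i, s i) (∑ i, α i) - ∑ i, t i) (by rwa [Nat.add_sub_cancel' ht]) (hdeg c t)
    rw [Nat.add_sub_cancel' ht] at h
    exact h.symm
  rw [← qMoment_prod_qShiftedProd hq, ← qMoment_prod_qShiftedProd hq, pad _ _ (le_max_left _ _),
    pad _ _ (le_max_right _ _), prod_qShiftedProd_mixedSum s α q (le_max_left _ _) (le_max_right _ _)]

end Moment

/-- The part of `Phi` depending only on the sizes, shifted by `P`. -/
noncomputable def PhiWeight (q lam mu : ℂ) (P k N : ℕ) : ℂ :=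
  (mu / lam) ^ (P + k) * qPoch q lam (P + k) * qPoch q (mu / lam) (N - k) / qPoch q mu (P + N)

lemma PhiWeight_recurrence {q lam mu : ℂ} (hlam : lam ≠ 0) (P : ℕ) {k N : ℕ} (hk : k ≤ N)
    (hN : qPoch q mu (P + (N + 1)) ≠ 0) :
    PhiWeight q lam mu P k N
      = PhiWeight q lam mu P k (N + 1) + q ^ (N - k) * PhiWeight q lam mu P (k + 1) (N + 1) := by
  obtain ⟨d, rfl⟩ := Nat.exists_eq_add_of_le hk
  obtain ⟨t, rfl⟩ : ∃ t, mu = t * lam := ⟨mu / lam, (div_mul_cancel₀ _ hlam).symm⟩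
  simp only [PhiWeight]
  rw [mul_div_cancel_right₀ _ hlam, show k + d + 1 - k = d + 1 by omega,
    show k + d + 1 - (k + 1) = d by omega, show k + d - k = d by omega]
  rw [← add_assoc P (k + d) 1, qPoch_succ] at hN ⊢
  obtain ⟨h1, h2⟩ := mul_ne_zero_iff.1 hN
  rw [← add_assoc P k 1, qPoch_succ, qPoch_succ]
  generalize hx : 1 - t * lam * q ^ (P + (k + d)) = x at *
  field_simp
  rw [← hx]
  ring

section Phi

variable {N : ℕ}

lemma phi_add_left (x y z : Fin N → ℤ) : phi (x + y) z = phi x z + phi y z := by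
  simp only [phi, ← Finset.sum_add_distrib, Pi.add_apply]
  refine Finset.sum_congr rfl fun i _ => Finset.sum_congr rfl fun j _ => ?_
  split_ifs <;> ring

lemma phi_sub_left (x y z : Fin N → ℤ) : phi (x - y) z = phi x z - phi y z := by
  have := phi_add_left (x - y) y z
  rw [sub_add_cancel] at this
  omega

lemma phi_add_right (x y z : Fin N → ℤ) : phi x (y + z) = phi x y + phi x z := by
  simp only [phi, ← Finset.sum_add_distrib, Pi.add_apply]
  refine Finset.sum_congr rfl fun i _ => Finset.sum_congr rfl fun j _ => ?_
  split_ifs <;> ring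

lemma phi_swap (x y : Fin N → ℤ) : phi x y = ∑ i, ∑ j, if j < i then x j * y i else 0 :=
  Finset.sum_comm

lemma phi_snoc (x y : Fin N → ℤ) (b : ℤ) :
    phi (Fin.snoc x 0 : Fin (N + 1) → ℤ) (Fin.snoc y b : Fin (N + 1) → ℤ)
      = phi x y + (∑ i, x i) * b := by
  simp [phi, Fin.sum_univ_castSucc, Fin.castSucc_lt_last, Finset.sum_add_distrib, Finset.sum_mul,
    Fin.not_lt.2 (Fin.le_last _)]

lemma choose_two_sum (m : Fin N → ℕ) :
    ((∑ i, m i).choose 2 : ℤ)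
      = ∑ i, ((m i).choose 2 : ℤ) + phi (fun i => (m i : ℤ)) (fun i => (m i : ℤ)) := by
  induction N with
  | zero => simp [phi]
  | succ N ih =>
    have h2 : ∀ a b : ℕ, ((a + b).choose 2 : ℤ) = a.choose 2 + b.choose 2 + a * b := by
      intro a b
      have := Nat.add_choose_eq a b 2
      simp [Finset.Nat.antidiagonal_succ] at this
      rw [this]
      push_cast
      ring
    have hphi : phi (fun i => (m i : ℤ)) (fun i => (m i : ℤ))
        = phi (fun i : Fin N => (m i.castSucc : ℤ)) (fun i => (m i.castSucc : ℤ))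
          + (∑ i : Fin N, (m i.castSucc : ℤ)) * m (Fin.last N) := by
      simp [phi, Fin.sum_univ_castSucc, Fin.castSucc_lt_last, Finset.sum_add_distrib,
        Finset.sum_mul, Fin.not_lt.2 (Fin.le_last _)]
    rw [hphi, Fin.sum_univ_castSucc, Fin.sum_univ_castSucc, h2, ih fun i => m i.castSucc]
    push_cast
    ring

lemma sum_mixedSum_castSucc_mul (s α m : Fin N → ℕ) :
    ∑ i, (mixedSum s α i.castSucc : ℤ) * m i
      = phi (fun i => (m i : ℤ)) (fun i => (α i : ℤ)) + phi (fun i => (s i : ℤ)) (fun i => (m i : ℤ))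
        + ∑ i, (m i : ℤ) * α i := by
  rw [phi_swap fun i => (s i : ℤ), phi, ← Finset.sum_add_distrib, ← Finset.sum_add_distrib]
  refine Finset.sum_congr rfl fun i _ => ?_
  rw [← Fintype.sum_ite_eq i fun j => (m i : ℤ) * α j, ← Finset.sum_add_distrib,
    ← Finset.sum_add_distrib, mixedSum, Nat.cast_sum, Finset.sum_mul]
  refine Finset.sum_congr rfl fun j _ => ?_
  simp only [Fin.castSucc_lt_castSucc_iff]
  rcases lt_trichotomy i j with h | rfl | h
  · simp [h.not_gt, h.ne, h, mul_comm]
  · simp [mul_comm]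
  · simp [h, h.not_gt, h.ne']

lemma sum_mixedSum_succ_mul (s α m : Fin N → ℕ) :
    ∑ i, (mixedSum s α i.succ : ℤ) * m i
      = phi (fun i => (m i : ℤ)) (fun i => (α i : ℤ)) + phi (fun i => (s i : ℤ)) (fun i => (m i : ℤ))
        + ∑ i, (m i : ℤ) * s i := by
  have h : ∀ i, (mixedSum s α i.succ : ℤ) * m i
      = mixedSum s α i.castSucc * m i + m i * s i - m i * α i := by
    intro i
    have := mixedSum_castSucc_add s α i
    zify at this
    linear_combination (-(m i : ℤ)) * this
  simp only [h, Finset.sum_sub_distrib, Finset.sum_add_distrib, sum_mixedSum_castSucc_mul]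
  ring

lemma phi_exponent (p s α m : Fin N → ℤ) :
    phi (p + m) (p + α) + phi (s - m) (p + m)
      = phi p (p + α) + phi s p + (phi m α + phi s m - phi m m) := by
  simp only [phi_add_left, phi_add_right, phi_sub_left]
  ring

end Phi

lemma sum_Iic_add {N : ℕ} (p s : Fin N → ℕ) (f : (Fin N → ℕ) → ℂ) (hf : ∀ m, ¬ p ≤ m → f m = 0) :
    ∑ m ∈ Finset.Iic (p + s), f m = ∑ m ∈ Finset.Iic s, f (p + m) := by
  symm
  refine Finset.sum_of_injOn (fun m => p + m) (fun _ _ _ _ h => add_left_cancel h) ?_ ?_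
    fun _ _ => rfl
  · intro m hm
    simpa using hm
  · intro m hm hnot
    refine hf m fun hle => hnot ?_
    obtain ⟨d, rfl⟩ := exists_add_of_le hle
    exact ⟨d, by simpa using hm, rfl⟩

lemma Phi_add {N : ℕ} (q lam mu : ℂ) (p : Fin N → ℕ) {s m : Fin N → ℕ} (h : m ≤ s) :
    Phi N q lam mu (p + m) (p + s)
      = q ^ phi (fun i => (s i : ℤ) - m i) (fun i => (p i : ℤ) + m i)
        * PhiWeight q lam mu (∑ i, p i) (∑ i, m i) (∑ i, s i)
        * ∏ i, qBinom q (p i + s i) (p i + m i) := by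
  rw [Phi, if_pos (add_le_add le_rfl h), PhiWeight]
  simp only [Pi.add_apply, Finset.sum_add_distrib, Nat.cast_add, add_sub_add_left_eq_sub,
    Nat.add_sub_add_left]
  ring

/-- A summand of either side of the identity (`t = s` or `t = α`), with the shift by `p` extracted
into a prefactor independent of `m`. -/
lemma noi_summand {N : ℕ} {q : ℂ} (hq0 : q ≠ 0) (hq : notRootOfUnity q) (lam mu : ℂ)
    (p s α : Fin N → ℕ) {t m : Fin N → ℕ} (h : m ≤ t) (c b e : Fin N → ℕ) (x : ℤ)
    (hx : x + phi (fun i => (t i : ℤ) - m i) (fun i => (p i : ℤ) + m i)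
      = phi (fun i => ((p + m) i : ℤ)) (fun i => ((p + α) i : ℤ))
        + phi (fun i => (s i : ℤ) - m i) (fun i => (p i : ℤ) + m i))
    (hc : ∑ i, (c i : ℤ) * m i
      = phi (fun i => (m i : ℤ)) (fun i => (α i : ℤ)) + phi (fun i => (s i : ℤ)) (fun i => (m i : ℤ))
        + ∑ i, (m i : ℤ) * e i) :
    q ^ x * Phi N q lam mu (p + m) (p + t)
        * ∏ i, (q ^ ((((p + m) i : ℕ) - p i : ℤ) * (((p + e) i : ℕ) - p i : ℤ))
          * qBinom q (b i) (p i) * qBinom q ((p + m) i) (p i))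
      = (q ^ (phi (fun i => (p i : ℤ)) (fun i => (p i : ℤ) + α i)
            + phi (fun i => (s i : ℤ)) (fun i => (p i : ℤ)))
          * ∏ i, qBinom q (b i) (p i) * qBinom q (p i + t i) (p i))
        * ((∏ i, qBinom q (t i) (m i) * q ^ ((m i).choose 2 + c i * m i))
          * ((q ^ (∑ i, m i).choose 2)⁻¹
            * PhiWeight q lam mu (∑ i, p i) (∑ i, m i) (∑ i, t i))) := by
  have hb : (∏ i, qBinom q (p i + t i) (p i + m i)) * ∏ i, qBinom q (p i + m i) (p i)
      = (∏ i, qBinom q (p i + t i) (p i)) * ∏ i, qBinom q (t i) (m i) := by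
    rw [← Finset.prod_mul_distrib, ← Finset.prod_mul_distrib]
    exact Finset.prod_congr rfl fun i _ => qBinom_mul_qBinom hq _ (h i)
  have hprod : ∀ f : Fin N → ℤ, ∏ i, q ^ f i = q ^ ∑ i, f i := fun f => by
    induction (Finset.univ : Finset (Fin N)) using Finset.induction_on with
    | empty => simp
    | insert a S ha ih => rw [Finset.prod_insert ha, Finset.sum_insert ha, ih, zpow_add₀ hq0]
  have hexp : q ^ x * q ^ phi (fun i => (t i : ℤ) - m i) (fun i => (p i : ℤ) + m i)
        * (∏ i, q ^ ((m i : ℤ) * e i))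
      = q ^ (phi (fun i => (p i : ℤ)) (fun i => (p i : ℤ) + α i)
            + phi (fun i => (s i : ℤ)) (fun i => (p i : ℤ)))
        * (∏ i, q ^ ((m i).choose 2 + c i * m i)) * (q ^ (∑ i, m i).choose 2)⁻¹ := by
    rw [Finset.prod_pow_eq_pow_sum, ← zpow_natCast, ← zpow_natCast, ← zpow_neg, hprod,
      ← zpow_add₀ hq0, ← zpow_add₀ hq0, ← zpow_add₀ hq0, ← zpow_add₀ hq0, hx]
    congr 1
    have h1 := phi_exponent (fun i => (p i : ℤ)) (fun i => (s i : ℤ)) (fun i => (α i : ℤ))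
      (fun i => (m i : ℤ))
    have h2 := choose_two_sum m
    simp only [Pi.add_def, Pi.sub_def] at h1
    push_cast [Finset.sum_add_distrib, Pi.add_apply]
    linear_combination h1 - hc + h2
  rw [Phi_add q lam mu p h]
  simp only [Pi.add_apply, Nat.cast_add, add_sub_cancel_left, Finset.prod_mul_distrib] at hexp ⊢
  linear_combination
    (∏ i, qBinom q (b i) (p i)) * PhiWeight q lam mu (∑ i, p i) (∑ i, m i) (∑ i, t i)
      * ((∏ i, q ^ ((m i : ℤ) * e i)) * q ^ x
          * q ^ phi (fun i => (t i : ℤ) - m i) (fun i => (p i : ℤ) + m i) * hb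
        + (∏ i, qBinom q (p i + t i) (p i)) * (∏ i, qBinom q (t i) (m i)) * hexp)

/-- The identity for vectors `s` and `α` of the same length. -/
lemma noi_identity_symm {N : ℕ} {q lam mu : ℂ} (hq0 : q ≠ 0) (hq : notRootOfUnity q)
    (hlam : lam ≠ 0) (α s p : Fin N → ℕ) (hps : p ≤ s) (hpα : p ≤ α)
    (hs : qPoch q mu (∑ i, s i) ≠ 0) (hα : qPoch q mu (∑ i, α i) ≠ 0) :
    ∑ m ∈ Finset.Iic s,
      q ^ phi (fun i => (m i : ℤ)) (fun i => (α i : ℤ)) * Phi N q lam mu m s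
        * ∏ i, (q ^ (((m i : ℤ) - p i) * ((α i : ℤ) - p i))
              * qBinom q (α i) (p i) * qBinom q (m i) (p i))
    = ∑ γ ∈ Finset.Iic α,
        q ^ (phi (fun i => (γ i : ℤ)) (fun i => (α i : ℤ))
              + phi (fun i => (s i : ℤ) - (α i : ℤ)) (fun i => (γ i : ℤ)))
          * Phi N q lam mu γ α
          * ∏ i, (q ^ (((γ i : ℤ) - p i) * ((s i : ℤ) - p i))
                * qBinom q (s i) (p i) * qBinom q (γ i) (p i)) := by
  obtain ⟨s, rfl⟩ := exists_add_of_le hps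
  obtain ⟨α, rfl⟩ := exists_add_of_le hpα
  have hvanish : ∀ (m : Fin N → ℕ) (f : Fin N → ℂ), ¬ p ≤ m →
      ∏ i, (f i * qBinom q (m i) (p i)) = 0 := by
    intro m f hm
    obtain ⟨i, hi⟩ := not_forall.1 hm
    exact Finset.prod_eq_zero (Finset.mem_univ i) (by rw [qBinom_of_lt (not_le.1 hi), mul_zero])
  rw [sum_Iic_add p s _ fun m hm => by rw [hvanish m _ hm, mul_zero],
    sum_Iic_add p α _ fun m hm => by rw [hvanish m _ hm, mul_zero]]
  rw [Finset.sum_congr rfl fun m hm => noi_summand hq0 hq lam mu p s α (Finset.mem_Iic.1 hm)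
      (fun i => mixedSum s α i.castSucc) (p + α) α _ rfl (sum_mixedSum_castSucc_mul s α m),
    Finset.sum_congr rfl fun m hm => noi_summand hq0 hq lam mu p s α (Finset.mem_Iic.1 hm)
      (fun i => mixedSum s α i.succ) (p + s) s _ ?_ (sum_mixedSum_succ_mul s α m),
    ← Finset.mul_sum, ← Finset.mul_sum,
    sum_mixedSum_duality (W := PhiWeight q lam mu (∑ i, p i)) hq0 hq s α]
  · congr 2
    exact Finset.prod_congr rfl fun i _ => mul_comm _ _
  · intro M hM k hk
    refine PhiWeight_recurrence hlam _ hk ?_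
    simp only [Pi.add_apply, Finset.sum_add_distrib] at hs hα
    rcases lt_max_iff.1 hM with h | h
    · exact qPoch_ne_zero_of_le (by omega) hs
    · exact qPoch_ne_zero_of_le (by omega) hα
  · have e1 := phi_add_left (fun i => (s i : ℤ) - α i) (fun i => (α i : ℤ) - m i)
      (fun i => (p i : ℤ) + m i)
    simp only [Pi.add_def, sub_add_sub_cancel] at e1
    simp only [Pi.add_apply, Nat.cast_add, add_sub_add_left_eq_sub, e1]
    ring

lemma Phi_snoc {n : ℕ} {q : ℂ} (hq : notRootOfUnity q) (lam mu : ℂ) (m s : Fin n → ℕ) :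
    Phi (n + 1) q lam mu (Fin.snoc m 0) (Fin.snoc s 0) = Phi n q lam mu m s := by
  have hle : (Fin.snoc m 0 : Fin (n + 1) → ℕ) ≤ Fin.snoc s 0 ↔ m ≤ s := by
    simp [Pi.le_def, Fin.forall_fin_succ']
  have hsub : (fun i => ((Fin.snoc s 0 : Fin (n + 1) → ℕ) i : ℤ)
        - (Fin.snoc m 0 : Fin (n + 1) → ℕ) i)
      = Fin.snoc (fun i => (s i : ℤ) - m i) 0 :=
    funext (Fin.lastCases (by simp) (by simp))
  have hm : (fun i => ((Fin.snoc m 0 : Fin (n + 1) → ℕ) i : ℤ))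
      = Fin.snoc (fun i => (m i : ℤ)) 0 :=
    funext (Fin.lastCases (by simp) (by simp))
  simp only [Phi, hsub, hm, phi_snoc, Fin.sum_univ_castSucc, Fin.prod_univ_castSucc,
    Fin.snoc_castSucc, Fin.snoc_last, mul_zero, add_zero, qBinom_self hq, mul_one]
  by_cases h : m ≤ s
  · rw [if_pos h, if_pos (hle.2 h)]
  · rw [if_neg h, if_neg (mt hle.1 h)]

lemma sum_Iic_snoc_zero {n : ℕ} (s : Fin n → ℕ) (f : (Fin (n + 1) → ℕ) → ℂ) :
    ∑ m ∈ Finset.Iic (Fin.snoc s 0 : Fin (n + 1) → ℕ), f m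
      = ∑ m ∈ Finset.Iic s, f (Fin.snoc m 0) := by
  symm
  refine Finset.sum_of_injOn (fun m => (Fin.snoc m 0 : Fin (n + 1) → ℕ)) ?_ ?_ ?_ fun _ _ => rfl
  · intro a _ b _ h
    simpa using congrArg Fin.init h
  · intro m hm
    simpa [Pi.le_def, Fin.forall_fin_succ'] using hm
  · intro m hm hnot
    simp only [Finset.mem_Iic, Pi.le_def, Fin.forall_fin_succ', Fin.snoc_castSucc,
      Fin.snoc_last, Nat.le_zero] at hm
    refine absurd ⟨Fin.init m, ?_, ?_⟩ hnot
    · simpa [Pi.le_def, Fin.init] using hm.1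
    · rw [← hm.2]
      exact Fin.snoc_init_self m

/-- The identity (noi) of Kuniba–Okado:
`Σ_{m ≤ s} q^{φ(m,α)} Φ_q^{(n)}(m|s;λ,μ) ∏_i q^{(m_i−p_i)(α_i−p_i)} binom(α_i,p_i)_q binom(m_i,p_i)_q
 = Σ_{γ ≤ α} q^{φ(γ,α)+φ(s^∨−α,γ)} Φ_q^{(n+1)}(γ|α;λ,μ)
     ∏_i q^{(γ_i−p_i)(s_i−p_i)} binom(s_i,p_i)_q binom(γ_i,p_i)_q`,
where `s^∨ = (s_1,…,s_n,0)` and `m` is padded with a trailing zero inside `φ(m,α)`. -/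
theorem noi_identity (n : ℕ) (hn : 1 ≤ n) (q lam mu : ℂ) (hq0 : q ≠ 0)
    (hq : notRootOfUnity q) (hlam : lam ≠ 0)
    (α : Fin (n + 1) → ℕ) (s p : Fin n → ℕ)
    (hp : ∀ i, p i ≤ min (s i) (α i.castSucc))
    (hs : qPoch q mu (∑ i, s i) ≠ 0) (hα : qPoch q mu (∑ i, α i) ≠ 0) :
    ∑ m ∈ Finset.Iic s,
      q ^ phi (fun i => ((Fin.snoc m 0 : Fin (n + 1) → ℕ) i : ℤ)) (fun i => (α i : ℤ))
        * Phi n q lam mu m s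
        * ∏ i : Fin n,
            (q ^ (((m i : ℤ) - p i) * ((α i.castSucc : ℤ) - p i))
              * qBinom q (α i.castSucc) (p i) * qBinom q (m i) (p i))
    = ∑ γ ∈ Finset.Iic α,
        q ^ (phi (fun i => (γ i : ℤ)) (fun i => (α i : ℤ))
              + phi (fun i => ((Fin.snoc s 0 : Fin (n + 1) → ℕ) i : ℤ) - (α i : ℤ))
                  (fun i => (γ i : ℤ)))
          * Phi (n + 1) q lam mu γ α
          * ∏ i : Fin n,
              (q ^ (((γ i.castSucc : ℤ) - p i) * ((s i : ℤ) - p i))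
                * qBinom q (s i) (p i) * qBinom q (γ i.castSucc) (p i)) := by
  have h := noi_identity_symm (mu := mu) hq0 hq hlam α (Fin.snoc s 0) (Fin.snoc p 0)
    (by simpa [Pi.le_def, Fin.forall_fin_succ'] using fun i => (le_min_iff.1 (hp i)).1)
    (by simpa [Pi.le_def, Fin.forall_fin_succ'] using fun i => (le_min_iff.1 (hp i)).2)
    (by simpa [Fin.sum_univ_castSucc] using hs) hα
  rw [sum_Iic_snoc_zero] at h
  simpa [Phi_snoc hq, Fin.prod_univ_castSucc, qBinom_zero_right hq] using h
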